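/- Under the hypotheses of the truncated covariance bound, choosing N = n^{-1/2} α^{-1/(2+δ)} yields |E[ητ] − E[η]E[τ]| ≤ (4/n + 2n^{δ/2}(C₁+C₂) + 2n^{δ/2}√(C₁C₂)) · α^{δ/(2+δ)} for any n > 0. -/

import Mathlib

open MeasureTheory ProbabilityTheory

section Covariance

variable {Ω : Type*} {m : MeasurableSpace Ω} {μ : Measure Ω} [IsProbabilityMeasure μ]
  {X Y : Ω → ℝ} {M N : ℝ}

lemma covariance_eq_integral_mul_condExp_sub {𝓐 : MeasurableSpace Ω} (h𝓐 : 𝓐 ≤ m)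
    (hX : Measurable[𝓐] X) (hXM : ∀ ω, |X ω| ≤ M) (hY : MemLp Y 2 μ) :
    cov[X, Y; μ] = ∫ ω, X ω * (μ[fun ω ↦ Y ω - μ[Y] | 𝓐]) ω ∂μ := by
  have hX2 : MemLp X 2 μ :=
    MemLp.of_bound (hX.mono h𝓐 le_rfl).aestronglyMeasurable M (ae_of_all _ hXM)
  have hYi : Integrable Y μ := hY.integrable (by norm_num)
  have hW : Integrable (fun ω ↦ Y ω - μ[Y]) μ := hYi.sub (integrable_const _)
  have hpull := condExp_stronglyMeasurable_mul_of_bound h𝓐 hX.stronglyMeasurable hW M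
    (ae_of_all _ hXM)
  have hXi : Integrable X μ := hX2.integrable (by norm_num)
  have hXY : Integrable (fun ω ↦ X ω * Y ω) μ := hX2.integrable_mul hY
  calc cov[X, Y; μ] = ∫ ω, X ω * (Y ω - μ[Y]) ∂μ := by
        rw [covariance_eq_sub hX2 hY]
        simp_rw [mul_sub]
        rw [integral_sub hXY (hXi.mul_const _), integral_mul_const]
        rfl
    _ = ∫ ω, (μ[X * fun ω ↦ Y ω - μ[Y] | 𝓐]) ω ∂μ := (integral_condExp h𝓐).symm
    _ = _ := integral_congr_ae hpull

lemma exists_measurableSet_abs_covariance_le {𝓐 : MeasurableSpace Ω} (h𝓐 : 𝓐 ≤ m)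
    (hX : Measurable[𝓐] X) (hXM : ∀ ω, |X ω| ≤ M) (hY : MemLp Y 2 μ) :
    ∃ A, MeasurableSet[𝓐] A ∧ |cov[X, Y; μ]| ≤ 2 * M * cov[A.indicator 1, Y; μ] := by
  set Z := μ[fun ω ↦ Y ω - μ[Y] | 𝓐] with hZ
  have hZm : Measurable[𝓐] Z := stronglyMeasurable_condExp.measurable
  have hZi : Integrable Z μ := integrable_condExp
  have hA : MeasurableSet[𝓐] {ω | 0 ≤ Z ω} := hZm measurableSet_Ici
  set A := {ω | 0 ≤ Z ω} with hAdef
  refine ⟨A, hA, ?_⟩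
  have hM : 0 ≤ M := by
    obtain ⟨ω⟩ := nonempty_of_isProbabilityMeasure μ
    exact (abs_nonneg _).trans (hXM ω)
  have hIm : Measurable[𝓐] (A.indicator (1 : Ω → ℝ)) := measurable_one.indicator hA
  have hI2 : MemLp (A.indicator (1 : Ω → ℝ)) 2 μ :=
    (memLp_const 1).indicator (h𝓐 _ hA)
  set S : Ω → ℝ := fun ω ↦ 2 * M * A.indicator 1 ω - M with hS
  have hSm : Measurable[𝓐] S := (hIm.const_mul _).sub_const _
  have hSM : ∀ ω, |S ω| ≤ M := by
    intro ω
    by_cases h : ω ∈ A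
    · simp only [hS, h, Set.indicator_of_mem, Pi.one_apply]
      rw [abs_le]; constructor <;> linarith
    · simp only [hS, h, not_false_eq_true, Set.indicator_of_notMem]
      rw [abs_le]; constructor <;> linarith
  have hSZ : ∀ ω, S ω * Z ω = M * |Z ω| := by
    intro ω
    by_cases h : 0 ≤ Z ω
    · have : ω ∈ A := h
      simp only [hS, this, Set.indicator_of_mem, Pi.one_apply, abs_of_nonneg h]
      ring
    · have : ω ∉ A := h
      simp only [hS, this, not_false_eq_true, Set.indicator_of_notMem, abs_of_neg (not_le.1 h)]
      ring
  have hcov : cov[S, Y; μ] = 2 * M * cov[A.indicator 1, Y; μ] := by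
    rw [hS, covariance_sub_const_left ((hI2.integrable (by norm_num)).const_mul _),
      covariance_const_mul_left]
  rw [← hcov, covariance_eq_integral_mul_condExp_sub h𝓐 hX hXM hY,
    covariance_eq_integral_mul_condExp_sub h𝓐 hSm hSM hY, ← hZ]
  simp_rw [hSZ]
  refine norm_integral_le_of_norm_le (f := fun ω ↦ X ω * Z ω) (hZi.abs.const_mul M)
    (ae_of_all _ fun ω ↦ ?_)
  rw [Real.norm_eq_abs, abs_mul]
  exact mul_le_mul_of_nonneg_right (hXM ω) (abs_nonneg _)

lemma abs_covariance_le_of_mixing {𝓐 𝓑 : MeasurableSpace Ω} (h𝓐 : 𝓐 ≤ m) (h𝓑 : 𝓑 ≤ m) {α : ℝ}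
    (hα : ∀ A B : Set Ω, MeasurableSet[𝓐] A → MeasurableSet[𝓑] B →
      |(μ (A ∩ B)).toReal - (μ A).toReal * (μ B).toReal| ≤ α)
    (hX : Measurable[𝓐] X) (hXM : ∀ ω, |X ω| ≤ M) (hY : Measurable[𝓑] Y)
    (hYN : ∀ ω, |Y ω| ≤ N) :
    |cov[X, Y; μ]| ≤ 4 * M * N * α := by
  obtain ⟨ω⟩ := nonempty_of_isProbabilityMeasure μ
  have hM : 0 ≤ M := (abs_nonneg _).trans (hXM ω)
  have hN : 0 ≤ N := (abs_nonneg _).trans (hYN ω)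
  have hY2 : MemLp Y 2 μ :=
    MemLp.of_bound (hY.mono h𝓑 le_rfl).aestronglyMeasurable N (ae_of_all _ hYN)
  obtain ⟨A, hA, hXA⟩ := exists_measurableSet_abs_covariance_le h𝓐 hX hXM hY2
  have hA2 : MemLp (A.indicator (1 : Ω → ℝ)) 2 μ := (memLp_const 1).indicator (h𝓐 _ hA)
  obtain ⟨B, hB, hYB⟩ := exists_measurableSet_abs_covariance_le h𝓑 hY hYN hA2
  have hB2 : MemLp (B.indicator (1 : Ω → ℝ)) 2 μ := (memLp_const 1).indicator (h𝓑 _ hB)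
  have hAB : cov[B.indicator 1, A.indicator 1; μ] ≤ α := by
    rw [covariance_comm, covariance_eq_sub hA2 hB2, ← Set.inter_indicator_one,
      integral_indicator_one (h𝓐 _ hA), integral_indicator_one (h𝓑 _ hB),
      integral_indicator_one ((h𝓐 _ hA).inter (h𝓑 _ hB))]
    exact (le_abs_self _).trans (hα A B hA hB)
  calc |cov[X, Y; μ]| ≤ 2 * M * cov[A.indicator 1, Y; μ] := hXA
    _ ≤ 2 * M * (2 * N * α) := by
        rw [covariance_comm]
        gcongr
        exact (le_abs_self _).trans (hYB.trans (by gcongr))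
    _ = 4 * M * N * α := by ring

lemma abs_covariance_le_of_abs_le (hX : MemLp X 2 μ) (hXM : ∀ ω, |X ω| ≤ M)
    (hY : MemLp Y 2 μ) : |cov[X, Y; μ]| ≤ 2 * M * ∫ ω, |Y ω| ∂μ := by
  have hYi : Integrable Y μ := hY.integrable (by norm_num)
  have h1 : |∫ ω, X ω * Y ω ∂μ| ≤ M * ∫ ω, |Y ω| ∂μ := by
    rw [← integral_const_mul]
    refine norm_integral_le_of_norm_le (f := fun ω ↦ X ω * Y ω) (hYi.abs.const_mul M)
      (ae_of_all _ fun ω ↦ ?_)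
    rw [Real.norm_eq_abs, abs_mul]
    exact mul_le_mul_of_nonneg_right (hXM ω) (abs_nonneg _)
  have h2 : |μ[X]| ≤ M := by
    simpa using norm_integral_le_of_norm_le_const (μ := μ) (f := X) (ae_of_all _ hXM)
  have h3 : |μ[Y]| ≤ ∫ ω, |Y ω| ∂μ := abs_integral_le_integral_abs
  rw [covariance_eq_sub hX hY]
  calc |μ[X * Y] - μ[X] * μ[Y]| ≤ |μ[X * Y]| + |μ[X] * μ[Y]| := abs_sub _ _
    _ ≤ M * ∫ ω, |Y ω| ∂μ + M * ∫ ω, |Y ω| ∂μ := by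
        rw [abs_mul]
        have hM : 0 ≤ M := (abs_nonneg _).trans h2
        exact add_le_add h1 (by gcongr)
    _ = _ := by ring

lemma abs_covariance_le_sqrt (hX : MemLp X 2 μ) (hY : MemLp Y 2 μ) :
    |cov[X, Y; μ]| ≤ √((∫ ω, X ω ^ 2 ∂μ) * ∫ ω, Y ω ^ 2 ∂μ) := by
  have hdisc : discrim Var[X; μ] (2 * cov[X, Y; μ]) Var[Y; μ] ≤ 0 := by
    refine discrim_le_zero fun t ↦ ?_
    have h := variance_nonneg (t • X + Y) μ
    rw [variance_add (hX.const_smul t) hY, variance_smul, covariance_smul_left] at h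
    linarith
  have hsq : cov[X, Y; μ] ^ 2 ≤ Var[X; μ] * Var[Y; μ] := by
    rw [discrim] at hdisc
    linarith
  refine Real.abs_le_sqrt (hsq.trans ?_)
  exact mul_le_mul (variance_le_expectation_sq hX.1) (variance_le_expectation_sq hY.1)
    (variance_nonneg _ _) (integral_nonneg fun ω ↦ sq_nonneg _)

end Covariance

section Truncation

variable {Ω : Type*} {m : MeasurableSpace Ω} {μ : Measure Ω} {X Y : Ω → ℝ} {N δ : ℝ}

lemma abs_sub_truncation_le (hN : 0 < N) (hδ : 0 < δ) (ω : Ω) :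
    |X ω - truncation X N ω| ≤ N ^ (-(1 + δ)) * |X ω| ^ (2 + δ) := by
  by_cases h : X ω ∈ Set.Ioc (-N) N
  · simp only [truncation, Function.comp_apply, Set.indicator_of_mem h, id, sub_self, abs_zero]
    positivity
  · simp only [truncation, Function.comp_apply, Set.indicator_of_notMem h, sub_zero]
    have hle : N ≤ |X ω| := by
      by_contra! hlt
      exact h ⟨(abs_lt.1 hlt).1, (abs_lt.1 hlt).2.le⟩
    have h0 : 0 < |X ω| := hN.trans_le hle
    rw [Real.rpow_neg hN.le, inv_mul_eq_div, le_div_iff₀ (by positivity),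
      show 2 + δ = 1 + (1 + δ) by ring, Real.rpow_add h0, Real.rpow_one]
    gcongr

lemma sq_sub_truncation_le (hN : 0 < N) (hδ : 0 < δ) (ω : Ω) :
    (X ω - truncation X N ω) ^ 2 ≤ N ^ (-δ) * |X ω| ^ (2 + δ) := by
  by_cases h : X ω ∈ Set.Ioc (-N) N
  · simp only [truncation, Function.comp_apply, Set.indicator_of_mem h, id, sub_self, ne_eq,
      OfNat.ofNat_ne_zero, not_false_eq_true, zero_pow]
    positivity
  · simp only [truncation, Function.comp_apply, Set.indicator_of_notMem h, sub_zero]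
    have hle : N ≤ |X ω| := by
      by_contra! hlt
      exact h ⟨(abs_lt.1 hlt).1, (abs_lt.1 hlt).2.le⟩
    have h0 : 0 < |X ω| := hN.trans_le hle
    rw [Real.rpow_neg hN.le, inv_mul_eq_div, le_div_iff₀ (by positivity),
      Real.rpow_add h0, Real.rpow_two, sq_abs]
    gcongr

lemma memLp_two_sub_truncation (hX : AEStronglyMeasurable X μ) (hN : 0 < N) (hδ : 0 < δ)
    (hint : Integrable (fun ω ↦ |X ω| ^ (2 + δ)) μ) : MemLp (X - truncation X N) 2 μ := by
  have hm : AEStronglyMeasurable (X - truncation X N) μ := hX.sub hX.truncation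
  refine (memLp_two_iff_integrable_sq hm).2 ((hint.const_mul (N ^ (-δ))).mono' (hm.pow 2)
    (ae_of_all _ fun ω ↦ ?_))
  rw [Real.norm_of_nonneg (sq_nonneg _)]
  exact sq_sub_truncation_le hN hδ ω

lemma integral_abs_sub_truncation_le (hN : 0 < N) (hδ : 0 < δ) {C : ℝ}
    (hint : Integrable (fun ω ↦ |X ω| ^ (2 + δ)) μ) (hC : ∫ ω, |X ω| ^ (2 + δ) ∂μ ≤ C) :
    ∫ ω, |(X - truncation X N) ω| ∂μ ≤ N ^ (-(1 + δ)) * C :=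
  calc ∫ ω, |(X - truncation X N) ω| ∂μ ≤ ∫ ω, N ^ (-(1 + δ)) * |X ω| ^ (2 + δ) ∂μ :=
        integral_mono_of_nonneg (ae_of_all _ fun ω ↦ abs_nonneg _) (hint.const_mul _)
          (ae_of_all _ fun ω ↦ abs_sub_truncation_le hN hδ ω)
    _ ≤ _ := by rw [integral_const_mul]; gcongr

lemma integral_sq_sub_truncation_le (hN : 0 < N) (hδ : 0 < δ) {C : ℝ}
    (hint : Integrable (fun ω ↦ |X ω| ^ (2 + δ)) μ) (hC : ∫ ω, |X ω| ^ (2 + δ) ∂μ ≤ C) :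
    ∫ ω, (X - truncation X N) ω ^ 2 ∂μ ≤ N ^ (-δ) * C :=
  calc ∫ ω, (X - truncation X N) ω ^ 2 ∂μ ≤ ∫ ω, N ^ (-δ) * |X ω| ^ (2 + δ) ∂μ :=
        integral_mono_of_nonneg (ae_of_all _ fun ω ↦ sq_nonneg _) (hint.const_mul _)
          (ae_of_all _ fun ω ↦ sq_sub_truncation_le hN hδ ω)
    _ ≤ _ := by rw [integral_const_mul]; gcongr

lemma memLp_two_of_integrable_rpow [IsFiniteMeasure μ] (hX : AEStronglyMeasurable X μ)
    (hδ : 0 < δ) (hint : Integrable (fun ω ↦ |X ω| ^ (2 + δ)) μ) : MemLp X 2 μ := by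
  simpa using (memLp_two_sub_truncation hX one_pos hδ hint).add (hX.memLp_truncation (A := 1))

lemma abs_covariance_le_of_mixing_of_truncation [IsProbabilityMeasure μ]
    {𝓐 𝓑 : MeasurableSpace Ω} (h𝓐 : 𝓐 ≤ m) (h𝓑 : 𝓑 ≤ m) {α : ℝ}
    (hα : ∀ A B : Set Ω, MeasurableSet[𝓐] A → MeasurableSet[𝓑] B →
      |(μ (A ∩ B)).toReal - (μ A).toReal * (μ B).toReal| ≤ α)
    (hX : Measurable[𝓐] X) (hY : Measurable[𝓑] Y) (hδ : 0 < δ) {C₁ C₂ : ℝ}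
    (hC₁ : ∫ ω, |X ω| ^ (2 + δ) ∂μ ≤ C₁) (hC₂ : ∫ ω, |Y ω| ^ (2 + δ) ∂μ ≤ C₂)
    (hint₁ : Integrable (fun ω ↦ |X ω| ^ (2 + δ)) μ)
    (hint₂ : Integrable (fun ω ↦ |Y ω| ^ (2 + δ)) μ) (hN : 0 < N) :
    |cov[X, Y; μ]| ≤
      4 * N ^ 2 * α + 2 * N ^ (-δ) * (C₁ + C₂) + 2 * N ^ (-δ) * √(C₁ * C₂) := by
  have hXm : AEStronglyMeasurable[m] X μ := (hX.mono h𝓐 le_rfl).aestronglyMeasurable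
  have hYm : AEStronglyMeasurable[m] Y μ := (hY.mono h𝓑 le_rfl).aestronglyMeasurable
  set X' := truncation X N with hX'
  set Y' := truncation Y N with hY'
  have hXb : ∀ ω, |X' ω| ≤ N := fun ω ↦ by
    simpa [abs_of_pos hN] using abs_truncation_le_bound X N ω
  have hYb : ∀ ω, |Y' ω| ≤ N := fun ω ↦ by
    simpa [abs_of_pos hN] using abs_truncation_le_bound Y N ω
  have hX'm : Measurable[𝓐] X' := (measurable_id.indicator measurableSet_Ioc).comp hX
  have hY'm : Measurable[𝓑] Y' := (measurable_id.indicator measurableSet_Ioc).comp hY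
  have hX'2 : MemLp X' 2 μ := hXm.memLp_truncation
  have hY'2 : MemLp Y' 2 μ := hYm.memLp_truncation
  have hXt := memLp_two_sub_truncation hXm hN hδ hint₁
  have hYt := memLp_two_sub_truncation hYm hN hδ hint₂
  have hC₁0 : 0 ≤ C₁ := le_trans (integral_nonneg fun ω ↦ by positivity) hC₁
  have hsplit : cov[X, Y; μ] = cov[X', Y'; μ] + cov[X', Y - Y'; μ] + cov[Y', X - X'; μ]
      + cov[X - X', Y - Y'; μ] := by
    rw [covariance_comm Y' (X - X')]
    conv_lhs => rw [← add_sub_cancel X' X, ← add_sub_cancel Y' Y]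
    rw [covariance_add_left hX'2 hXt (hY'2.add hYt), covariance_add_right hX'2 hY'2 hYt,
      covariance_add_right hXt hY'2 hYt]
    ring
  have hpow : N * N ^ (-(1 + δ)) = N ^ (-δ) := by
    nth_rw 1 [← Real.rpow_one N]
    rw [← Real.rpow_add hN]
    ring_nf
  have h1 : |cov[X', Y'; μ]| ≤ 4 * N ^ 2 * α := by
    have := abs_covariance_le_of_mixing h𝓐 h𝓑 hα hX'm hXb hY'm hYb
    rwa [mul_assoc 4 N N, ← sq] at this
  have h2 : |cov[X', Y - Y'; μ]| ≤ 2 * N ^ (-δ) * C₂ := by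
    rw [← hpow]
    have := mul_le_mul_of_nonneg_left (integral_abs_sub_truncation_le hN hδ hint₂ hC₂)
      (by positivity : 0 ≤ 2 * N)
    exact (abs_covariance_le_of_abs_le hX'2 hXb hYt).trans (this.trans_eq (by ring))
  have h3 : |cov[Y', X - X'; μ]| ≤ 2 * N ^ (-δ) * C₁ := by
    rw [← hpow]
    have := mul_le_mul_of_nonneg_left (integral_abs_sub_truncation_le hN hδ hint₁ hC₁)
      (by positivity : 0 ≤ 2 * N)
    exact (abs_covariance_le_of_abs_le hY'2 hYb hXt).trans (this.trans_eq (by ring))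
  have h4 : |cov[X - X', Y - Y'; μ]| ≤ N ^ (-δ) * √(C₁ * C₂) := by
    refine (abs_covariance_le_sqrt hXt hYt).trans ?_
    calc _ ≤ √((N ^ (-δ) * C₁) * (N ^ (-δ) * C₂)) := by
          refine Real.sqrt_le_sqrt (mul_le_mul (integral_sq_sub_truncation_le hN hδ hint₁ hC₁)
            (integral_sq_sub_truncation_le hN hδ hint₂ hC₂)
            (integral_nonneg fun ω ↦ sq_nonneg _) (by positivity))
      _ = N ^ (-δ) * √(C₁ * C₂) := by
          rw [mul_mul_mul_comm, Real.sqrt_mul (by positivity), Real.sqrt_mul_self (by positivity)]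
  have h5 : 0 ≤ N ^ (-δ) * √(C₁ * C₂) := by positivity
  rw [hsplit]
  refine (abs_add_le _ _).trans ?_
  have h6 := abs_add_three cov[X', Y'; μ] cov[X', Y - Y'; μ] cov[Y', X - X'; μ]
  linarith

end Truncation

/-- Optimized covariance bound under alpha-mixing: with
`E|η|^(2+δ) ≤ C₁`, `E|τ|^(2+δ) ≤ C₂` and mixing coefficient bounded by `α ∈ (0,1]`,
for any `n > 0`,
`|E[ητ] − E[η]E[τ]| ≤ (4/n + 2n^{δ/2}(C₁+C₂) + 2n^{δ/2}√(C₁C₂)) α^{δ/(2+δ)}`. -/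
theorem stmt5
    {Ω : Type*} {m : MeasurableSpace Ω} (μ : Measure Ω) [IsProbabilityMeasure μ]
    (𝓐 𝓑 : MeasurableSpace Ω) (h𝓐 : 𝓐 ≤ m) (h𝓑 : 𝓑 ≤ m)
    (η τ : Ω → ℝ)
    (hη : Measurable[𝓐] η) (hτ : Measurable[𝓑] τ)
    (δ : ℝ) (hδ : 0 < δ) (C₁ C₂ : ℝ)
    (hC₁ : ∫ ω, |η ω| ^ (2 + δ) ∂μ ≤ C₁)
    (hC₂ : ∫ ω, |τ ω| ^ (2 + δ) ∂μ ≤ C₂)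
    (hint₁ : Integrable (fun ω => |η ω| ^ (2 + δ)) μ)
    (hint₂ : Integrable (fun ω => |τ ω| ^ (2 + δ)) μ)
    (α : ℝ) (hα0 : 0 < α) (hα1 : α ≤ 1)
    (hα : ∀ A B : Set Ω, MeasurableSet[𝓐] A → MeasurableSet[𝓑] B →
      |(μ (A ∩ B)).toReal - (μ A).toReal * (μ B).toReal| ≤ α) :
    ∀ n : ℝ, 0 < n →
      |(∫ ω, η ω * τ ω ∂μ) - (∫ ω, η ω ∂μ) * (∫ ω, τ ω ∂μ)| ≤
        (4 / n + 2 * n ^ (δ / 2) * (C₁ + C₂) + 2 * n ^ (δ / 2) * Real.sqrt (C₁ * C₂)) *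
          α ^ (δ / (2 + δ)) := by
  intro n hn
  have hη' : AEStronglyMeasurable[m] η μ := (hη.mono h𝓐 le_rfl).aestronglyMeasurable
  have hτ' : AEStronglyMeasurable[m] τ μ := (hτ.mono h𝓑 le_rfl).aestronglyMeasurable
  have hcov := covariance_eq_sub (memLp_two_of_integrable_rpow hη' hδ hint₁)
    (memLp_two_of_integrable_rpow hτ' hδ hint₂)
  have hN : 0 < n ^ (-(1 / 2) : ℝ) * α ^ (-(1 / (2 + δ))) := by positivity
  have hbound := abs_covariance_le_of_mixing_of_truncation h𝓐 h𝓑 hα hη hτ hδ hC₁ hC₂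
    hint₁ hint₂ hN
  rw [hcov] at hbound
  have hNδ : (n ^ (-(1 / 2) : ℝ) * α ^ (-(1 / (2 + δ)))) ^ (-δ)
      = n ^ (δ / 2) * α ^ (δ / (2 + δ)) := by
    rw [Real.mul_rpow (by positivity) (by positivity), ← Real.rpow_mul hn.le,
      ← Real.rpow_mul hα0.le]
    congr 2 <;> ring
  have hNsq : (n ^ (-(1 / 2) : ℝ) * α ^ (-(1 / (2 + δ)))) ^ 2 * α
      = n⁻¹ * α ^ (δ / (2 + δ)) := by
    rw [← Real.rpow_two, Real.mul_rpow (by positivity) (by positivity), ← Real.rpow_mul hn.le,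
      ← Real.rpow_mul hα0.le, mul_assoc, ← Real.rpow_add_one hα0.ne', ← Real.rpow_neg_one]
    congr 2
    · ring
    · field_simp
      ring
  rw [hNδ, mul_assoc 4, hNsq] at hbound
  exact hbound.trans_eq (by ring)
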